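/- arXiv:0807.3506 — 2 statements merged into one kernel-verified Lean document; each statement's English description precedes it below -/
import Mathlib

section
/- Let X be normally distributed with mean μ > 0 and standard deviation σ > 0, and let α = 2μ/σ². Then sup_{x>0} ( -log E[e^{-α(X-x)} | X ≥ x] ) = log( Φ(μ/σ) / (1 - Φ(μ/σ)) ) and sup_{x<0} log E[e^{α(x-X)} | X < x] = log( Φ(μ/σ) / (1 - Φ(μ/σ)) ); that is, e^{α d^+} = e^{α d^-} = Φ(μ/σ)/(1 - Φ(μ/σ)), the suprema being attained in the limit x → 0. (This uses that the normal distribution has increasing failure rate, so the residual distributions L(X - x | X > x) are stochastically decreasing in x.) -/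
open MeasureTheory ProbabilityTheory

/-- The standard normal cumulative distribution function `Φ`. -/
noncomputable def stdNormalCDF (z : ℝ) : ℝ :=
  (gaussianReal 0 1 (Set.Iic z)).toReal

/-- `E[exp (-α (X - x)) | X ≥ x]`. -/
noncomputable def condExpGe {Ω : Type*} [MeasurableSpace Ω] (P : Measure Ω)
    (Y : Ω → ℝ) (α x : ℝ) : ℝ :=
  (∫ ω in {ω | x ≤ Y ω}, Real.exp (-α * (Y ω - x)) ∂P) / (P {ω | x ≤ Y ω}).toReal

/-- `E[exp (α (x - X)) | X < x]`. -/
noncomputable def condExpLt {Ω : Type*} [MeasurableSpace Ω] (P : Measure Ω)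
    (Y : Ω → ℝ) (α x : ℝ) : ℝ :=
  (∫ ω in {ω | Y ω < x}, Real.exp (α * (x - Y ω)) ∂P) / (P {ω | Y ω < x}).toReal

section aux
open Real Set Filter Topology

lemma aux_law_int {Ω : Type*} [MeasurableSpace Ω] (P : Measure Ω)
    (μ : ℝ) (v : NNReal) (hv : v ≠ 0) (X : Ω → ℝ) (hX : Measurable X)
    (hlaw : Measure.map X P = gaussianReal μ v) (S : Set ℝ) (hS : MeasurableSet S)
    (g : ℝ → ℝ) (hg : Measurable g) :
    ∫ ω in X ⁻¹' S, g (X ω) ∂P = ∫ y in S, gaussianPDFReal μ v y * g y := by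
  rw [← setIntegral_map hS hg.aestronglyMeasurable hX.aemeasurable, hlaw,
    ← integral_indicator hS, integral_gaussianReal_eq_integral_smul hv, ← integral_indicator hS]
  congr 1
  ext y
  by_cases hy : y ∈ S <;> simp [hy]

lemma aux_law_meas {Ω : Type*} [MeasurableSpace Ω] (P : Measure Ω) [IsProbabilityMeasure P]
    (μ : ℝ) (v : NNReal) (hv : v ≠ 0) (X : Ω → ℝ) (hX : Measurable X)
    (hlaw : Measure.map X P = gaussianReal μ v) (S : Set ℝ) (hS : MeasurableSet S) :
    (P (X ⁻¹' S)).toReal = ∫ y in S, gaussianPDFReal μ v y := by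
  have := aux_law_int P μ v hv X hX hlaw S hS (fun _ => 1) measurable_const
  simpa [Measure.real] using this

lemma aux_shift (f : ℝ → ℝ) (x : ℝ) : ∫ y in Ici x, f y = ∫ u in Ioi 0, f (u + x) := by
  rw [integral_Ici_eq_integral_Ioi, ← integral_indicator measurableSet_Ioi,
    ← integral_indicator measurableSet_Ioi, ← integral_add_right_eq_self _ x]
  congr 1
  ext y
  simp [indicator]

lemma aux_shift_neg (f : ℝ → ℝ) (x : ℝ) : ∫ y in Iio x, f y = ∫ u in Ioi 0, f (-(u + -x)) := by
  rw [← integral_indicator measurableSet_Iio,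
    ← integral_indicator measurableSet_Ioi, ← integral_neg_eq_self,
    ← integral_add_right_eq_self _ (-x)]
  congr 1
  ext y
  simp [indicator]

lemma aux_pdf_neg (μ σ : ℝ) (v : NNReal) (hc : (v : ℝ) = σ ^ 2) (hσ : 0 < σ) (z : ℝ) :
    gaussianPDFReal μ v (-z)
      = exp (-(2 * μ / σ ^ 2) * z) * gaussianPDFReal μ v z := by
  simp only [gaussianPDFReal]
  rw [hc]
  rw [mul_left_comm, ← exp_add]
  congr 2
  field_simp
  ring

lemma aux_pdf_add (μ σ : ℝ) (v : NNReal) (hc : (v : ℝ) = σ ^ 2) (hσ : 0 < σ) (x u : ℝ) :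
    gaussianPDFReal μ v (u + x)
      = exp (-(x ^ 2 - 2 * x * μ) / (2 * σ ^ 2)) * 
        (exp (-(x / σ ^ 2) * u) * gaussianPDFReal μ v u) := by
  simp only [gaussianPDFReal]
  rw [hc]
  rw [mul_left_comm (exp (-(x / σ ^ 2) * u)), mul_left_comm, ← exp_add, ← exp_add]
  congr 2
  field_simp
  ring

/-- Laplace transform of the positive part. -/
noncomputable def auxL (f : ℝ → ℝ) (s : ℝ) : ℝ := ∫ u in Ioi 0, exp (-s * u) * f u

lemma auxL_int (f : ℝ → ℝ) (hf : Integrable f) (s : ℝ) (hs : 0 ≤ s) :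
    Integrable (fun u => exp (-s * u) * f u) (volume.restrict (Ioi 0)) := by
  refine Integrable.bdd_mul (c := 1) hf.integrableOn (by fun_prop) ?_
  filter_upwards [ae_restrict_mem measurableSet_Ioi] with u hu
  rw [norm_eq_abs, abs_exp, exp_le_one_iff]
  have := mul_nonneg hs (le_of_lt hu)
  linarith

lemma auxL_pos (f : ℝ → ℝ) (hf : Integrable f) (hpos : ∀ u, 0 < f u) (s : ℝ) (hs : 0 ≤ s) :
    0 < auxL f s := by
  unfold auxL
  rw [integral_pos_iff_support_of_nonneg (fun u => (mul_pos (exp_pos _) (hpos u)).le)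
    (auxL_int f hf s hs)]
  have : Function.support (fun u => exp (-s * u) * f u) = univ := by
    ext u; simp [(hpos u).ne']
  rw [this]; simp

lemma auxL_tendsto (f : ℝ → ℝ) (hf : Integrable f) (s : ℝ) (hs : 0 ≤ s) :
    Tendsto (fun b => auxL f (s + b)) (𝓝[>] 0) (𝓝 (auxL f s)) := by
  unfold auxL
  refine tendsto_integral_filter_of_dominated_convergence (fun u => ‖f u‖) ?_ ?_
    hf.norm.integrableOn ?_
  · filter_upwards [self_mem_nhdsWithin] with b hb
    exact (auxL_int f hf (s + b) (add_nonneg hs (le_of_lt hb))).1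
  · filter_upwards [self_mem_nhdsWithin] with b hb
    filter_upwards [ae_restrict_mem measurableSet_Ioi] with u hu
    rw [norm_mul, norm_eq_abs, abs_exp]
    refine mul_le_of_le_one_left (norm_nonneg _) ?_
    rw [exp_le_one_iff]
    have := mul_nonneg (add_nonneg hs (le_of_lt hb)) (le_of_lt hu)
    linarith
  · refine ae_of_all _ fun u => ?_
    have : Continuous fun b : ℝ => exp (-(s + b) * u) * f u := by fun_prop
    have h := this.tendsto 0
    simp only [add_zero] at h
    exact h.mono_left nhdsWithin_le_nhds

lemma auxL_cheb (f : ℝ → ℝ) (hf : Integrable f) (hpos : ∀ u, 0 < f u) (a b : ℝ)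
    (ha : 0 < a) (hb : 0 ≤ b) :
    auxL f a / auxL f 0 ≤ auxL f (a + b) / auxL f b := by
  have h0 := auxL_pos f hf hpos 0 le_rfl
  have h1 := auxL_pos f hf hpos a ha.le
  have hB := auxL_pos f hf hpos b hb
  set m := auxL f a / auxL f 0 with hm
  have hmpos : 0 < m := div_pos h1 h0
  rw [le_div_iff₀ hB]
  obtain ⟨w, hw⟩ : ∃ w, exp (-a * w) = m := ⟨-log m / a, by
    rw [show -a * (-log m / a) = log m by field_simp, exp_log hmpos]⟩
  set k := exp (-b * w) with hk
  have key : 0 ≤ ∫ u in Ioi 0, (exp (-(a + b) * u) * f u - m * (exp (-b * u) * f u)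
      - k * (exp (-a * u) * f u) + k * m * (exp (-0 * u) * f u)) := by
    refine integral_nonneg fun u => ?_
    have e : exp (-(a + b) * u) * f u - m * (exp (-b * u) * f u)
      - k * (exp (-a * u) * f u) + k * m * (exp (-0 * u) * f u)
      = (exp (-a * u) - exp (-a * w)) * (exp (-b * u) - exp (-b * w)) * f u := by
      rw [show -(a + b) * u = -a * u + -b * u by ring, exp_add, hw, hk]
      simp; ring
    simp only [Pi.zero_apply]
    rw [e]
    refine mul_nonneg ?_ (hpos u).le
    rcases le_total u w with h | h
    · refine mul_nonneg (sub_nonneg.2 (exp_le_exp.2 ?_)) (sub_nonneg.2 (exp_le_exp.2 ?_)) <;>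
        nlinarith
    · refine mul_nonneg_of_nonpos_of_nonpos (sub_nonpos.2 (exp_le_exp.2 ?_))
        (sub_nonpos.2 (exp_le_exp.2 ?_)) <;> nlinarith
  have i1 := auxL_int f hf (a + b) (by linarith)
  have i2 := (auxL_int f hf b hb).const_mul m
  have i3 := (auxL_int f hf a ha.le).const_mul k
  have i4 := (auxL_int f hf 0 le_rfl).const_mul (k * m)
  rw [integral_add (by exact (i1.sub i2).sub i3) i4, integral_sub (by exact i1.sub i2) i3, integral_sub i1 i2,
    integral_const_mul, integral_const_mul, integral_const_mul] at key
  change 0 ≤ auxL f (a + b) - m * auxL f b - k * auxL f a + k * m * auxL f 0 at key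
  have : m * auxL f 0 = auxL f a := by rw [hm]; field_simp
  have : k * m * auxL f 0 = k * auxL f a := by rw [← this]; ring
  linarith

lemma aux_cdf (μ σ : ℝ) (hσ : 0 < σ) :
    stdNormalCDF (μ / σ) = (gaussianReal μ ⟨σ ^ 2, sq_nonneg σ⟩ (Ici 0)).toReal := by
  have h : (gaussianReal 0 1).map (fun z => μ + (-σ) * z)
      = gaussianReal μ ⟨σ ^ 2, sq_nonneg σ⟩ := by
    have h1 : (fun z : ℝ => μ + (-σ) * z) = (fun y => μ + y) ∘ (fun z => (-σ) * z) := rfl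
    rw [h1, ← Measure.map_map (by fun_prop) (by fun_prop), gaussianReal_map_const_mul,
      gaussianReal_map_const_add]
    congr 1
    · simp
    · ext; simp; rfl
  rw [← h, Measure.map_apply (by fun_prop) measurableSet_Ici, stdNormalCDF]
  congr 2
  ext z
  simp only [mem_Iic, mem_preimage, mem_Ici]
  rw [le_div_iff₀ hσ]
  constructor <;> intro h <;> linarith

end aux

/-- For `X ~ N(μ, σ²)` with `μ > 0`, `σ > 0` and `α = 2μ/σ²`,
`sup_{x > 0} (-log E[exp (-α (X - x)) | X ≥ x]) = log (Φ(μ/σ) / (1 - Φ(μ/σ)))` and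
`sup_{x < 0} log E[exp (α (x - X)) | X < x] = log (Φ(μ/σ) / (1 - Φ(μ/σ)))`;
that is, `exp (α d⁺) = exp (α d⁻) = Φ(μ/σ) / (1 - Φ(μ/σ))`. -/
theorem gaussian_dplus_dminus
    {Ω : Type*} [MeasurableSpace Ω] (P : Measure Ω) [IsProbabilityMeasure P]
    (μ σ : ℝ) (hμ : 0 < μ) (hσ : 0 < σ)
    (X : Ω → ℝ) (hX : Measurable X)
    (hlaw : Measure.map X P = gaussianReal μ ⟨σ ^ 2, sq_nonneg σ⟩)
    (α : ℝ) (hα : α = 2 * μ / σ ^ 2) :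
    sSup {y | ∃ x : ℝ, 0 < x ∧ y = -Real.log (condExpGe P X α x)}
        = Real.log (stdNormalCDF (μ / σ) / (1 - stdNormalCDF (μ / σ))) ∧
      sSup {y | ∃ x : ℝ, x < 0 ∧ y = Real.log (condExpLt P X α x)}
        = Real.log (stdNormalCDF (μ / σ) / (1 - stdNormalCDF (μ / σ))) := by
  have hσ2 : (0:ℝ) < σ ^ 2 := by positivity
  have hαpos : 0 < α := by rw [hα]; positivity
  set v : NNReal := ⟨σ ^ 2, sq_nonneg σ⟩ with hvdef
  have hv : v ≠ 0 := by
    intro h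
    exact hσ2.ne' (congrArg NNReal.toReal h)
  set f : ℝ → ℝ := gaussianPDFReal μ v with hfdef
  have hf : Integrable f := integrable_gaussianPDFReal μ v
  have hpos : ∀ u, 0 < f u := fun u => gaussianPDFReal_pos μ v u hv
  have hneg : ∀ z, f (-z) = Real.exp (-α * z) * f z := by
    intro z; rw [hα]; exact aux_pdf_neg μ σ v rfl hσ z
  have hadd : ∀ x, ∃ c, 0 < c ∧ ∀ u, f (u + x) = c * (Real.exp (-(x / σ ^ 2) * u) * f u) :=
    fun x => ⟨_, Real.exp_pos _, fun u => aux_pdf_add μ σ v rfl hσ x u⟩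
  -- values at zero
  have hL0 : auxL f 0 = stdNormalCDF (μ / σ) := by
    rw [aux_cdf μ σ hσ]
    have := aux_law_meas (gaussianReal μ v) μ v hv id measurable_id Measure.map_id
      (Set.Ici 0) measurableSet_Ici
    simp only [Set.preimage_id] at this
    rw [this, aux_shift]
    simp [auxL, hfdef]
  have hLa : auxL f α = 1 - stdNormalCDF (μ / σ) := by
    rw [aux_cdf μ σ hσ]
    have h1 := aux_law_meas (gaussianReal μ v) μ v hv id measurable_id Measure.map_id
      (Set.Iio 0) measurableSet_Iio
    simp only [Set.preimage_id] at h1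
    have h2 := probReal_compl_eq_one_sub (μ := gaussianReal μ v) (s := Set.Ici (0:ℝ))
      measurableSet_Ici
    rw [Set.compl_Ici] at h2
    simp only [Measure.real] at h2
    rw [← h2, h1, aux_shift_neg]
    unfold auxL
    congr 1
    ext u
    rw [neg_zero, add_zero]
    exact (hneg u).symm
  have hge : ∀ x, condExpGe P X α x = auxL f (α + x / σ ^ 2) / auxL f (x / σ ^ 2) := by
    intro x
    obtain ⟨c, hc, hcx⟩ := hadd x
    have h1 := aux_law_int P μ v hv X hX hlaw (Set.Ici x) measurableSet_Ici
      (fun y => Real.exp (-α * (y - x))) (by fun_prop)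
    have h2 := aux_law_meas P μ v hv X hX hlaw (Set.Ici x) measurableSet_Ici
    have e : {ω | x ≤ X ω} = X ⁻¹' (Set.Ici x) := rfl
    rw [condExpGe, e, h1, h2, aux_shift, aux_shift, ← hfdef]
    simp only [hcx]
    rw [integral_const_mul]
    have : ∀ u, c * (Real.exp (-(x / σ ^ 2) * u) * f u) * Real.exp (-α * (u + x - x))
        = c * (Real.exp (-(α + x / σ ^ 2) * u) * f u) := by
      intro u
      rw [show -(α + x / σ ^ 2) * u = -(x / σ ^ 2) * u + -α * (u + x - x) by ring, Real.exp_add]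
      ring
    simp only [this]
    rw [integral_const_mul]
    exact mul_div_mul_left _ _ hc.ne'
  have hlt : ∀ x, condExpLt P X α x = (condExpGe P X α (-x))⁻¹ := by
    intro x
    rw [hge, inv_div]
    obtain ⟨c, hc, hcx⟩ := hadd (-x)
    have h1 := aux_law_int P μ v hv X hX hlaw (Set.Iio x) measurableSet_Iio
      (fun y => Real.exp (α * (x - y))) (by fun_prop)
    have h2 := aux_law_meas P μ v hv X hX hlaw (Set.Iio x) measurableSet_Iio
    have e : {ω | X ω < x} = X ⁻¹' (Set.Iio x) := rfl
    rw [condExpLt, e, h1, h2, aux_shift_neg, aux_shift_neg, ← hfdef]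
    simp only [hneg, hcx]
    have t1 : ∀ u, Real.exp (-α * (u + -x)) * (c * (Real.exp (-(-x / σ ^ 2) * u) * f u))
          * Real.exp (α * (x - -(u + -x)))
        = (c * Real.exp (α * x)) * (Real.exp (-(-x / σ ^ 2) * u) * f u) := by
      intro u
      rw [show α * x = -α * (u + -x) + α * (x - -(u + -x)) by ring, Real.exp_add]
      ring
    have t2 : ∀ u, Real.exp (-α * (u + -x)) * (c * (Real.exp (-(-x / σ ^ 2) * u) * f u))
        = (c * Real.exp (α * x)) * (Real.exp (-(α + -x / σ ^ 2) * u) * f u) := by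
      intro u
      rw [show -α * (u + -x) = α * x + -α * u by ring,
        show -(α + -x / σ ^ 2) * u = -α * u + -(-x / σ ^ 2) * u by ring, Real.exp_add, Real.exp_add]
      ring
    simp only [t1]
    simp only [t2]
    rw [integral_const_mul, integral_const_mul]
    exact mul_div_mul_left _ _ (mul_pos hc (Real.exp_pos _)).ne'
  have hset : {y | ∃ x : ℝ, x < 0 ∧ y = Real.log (condExpLt P X α x)}
      = {y | ∃ x : ℝ, 0 < x ∧ y = -Real.log (condExpGe P X α x)} := by
    ext y
    constructor
    · rintro ⟨x, hx, rfl⟩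
      exact ⟨-x, by linarith, by rw [hlt, Real.log_inv]⟩
    · rintro ⟨x, hx, rfl⟩
      exact ⟨-x, by linarith, by rw [hlt, Real.log_inv, neg_neg]⟩
  have h0 := auxL_pos f hf hpos 0 le_rfl
  have ha := auxL_pos f hf hpos α hαpos.le
  have main : sSup {y | ∃ x : ℝ, 0 < x ∧ y = -Real.log (condExpGe P X α x)}
      = Real.log (stdNormalCDF (μ / σ) / (1 - stdNormalCDF (μ / σ))) := by
    rw [← hLa, ← hL0, ← inv_div, Real.log_inv]
    refine IsLUB.csSup_eq ⟨?_, ?_⟩ ⟨_, 1, one_pos, rfl⟩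
    · rintro y ⟨x, hx, rfl⟩
      rw [hge]
      exact neg_le_neg (Real.log_le_log (div_pos ha h0)
        (auxL_cheb f hf hpos α _ hαpos (div_pos hx hσ2).le))
    · intro y hy
      have t : Filter.Tendsto (fun b => -Real.log (auxL f (α + b) / auxL f (0 + b)))
          (nhdsWithin 0 (Set.Ioi 0)) (nhds (-Real.log (auxL f α / auxL f 0))) :=
        (((auxL_tendsto f hf α hαpos.le).div (auxL_tendsto f hf 0 le_rfl) h0.ne').log
          (div_pos ha h0).ne').neg
      refine le_of_tendsto t ?_
      filter_upwards [self_mem_nhdsWithin] with b hb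
      refine hy ⟨b * σ ^ 2, mul_pos hb hσ2, ?_⟩
      rw [hge, mul_div_cancel_right₀ _ hσ2.ne', zero_add]
  exact ⟨main, by rw [hset]; exact main⟩
end

section
/- Let θ > 0 and 0 < Δ < 1/θ, and let α > 0 satisfy e^{αΔ} = 1 + α/θ (the adjustment coefficient of the exponential distribution with rate θ shifted down by Δ). Then α > 2θ(1 - θΔ); that is, the adjustment coefficient strictly exceeds the Gaussian-motivated rate 2E[X]/Var[X] = 2θ(1 - θΔ) of the shifted exponential random variable X. -/
/-- If `θ > 0`, `0 < Δ < 1/θ`, and `α > 0` satisfies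
`exp (α Δ) = 1 + α/θ` (the adjustment coefficient of the exponential distribution with
rate `θ` shifted down by `Δ`), then `α > 2θ(1 - θΔ)`, the Gaussian-motivated rate
`2 E[X] / Var[X]` of the shifted exponential variable. -/
theorem shiftedExp_adjustment_gt_gaussian_rate
    (θ Δ α : ℝ) (hθ : 0 < θ) (hΔ : 0 < Δ) (hΔθ : Δ < 1 / θ)
    (hα : 0 < α) (hadj : Real.exp (α * Δ) = 1 + α / θ) :
    2 * θ * (1 - θ * Δ) < α := by
  have hu : 0 < α / θ := div_pos hα hθ
  have h1 := Real.le_log_one_add_of_nonneg hu.le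
  rw [← hadj, Real.log_exp] at h1
  obtain ⟨u, rfl⟩ : ∃ u, α = u * θ := ⟨α / θ, by field_simp⟩
  have e : u * θ / θ = u := by field_simp
  rw [e] at h1 hu
  have h2 : u - u ^ 2 / 2 < 2 * u / (u + 2) := by
    rw [lt_div_iff₀ (by linarith)]
    nlinarith [pow_pos hu 3]
  have h3 : u * (2 * (1 - θ * Δ)) < u * u := by nlinarith
  have h4 := lt_of_mul_lt_mul_left h3 hu.le
  nlinarith
end
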